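/- Let K ≥ 1, let G be a finitely generated nilpotent group, and let A be a K-approximate subgroup of G such that G = A·Z(G), where Z(G) is the centre of G. Then there exist an integer k ≤ K^8 and normal subgroups {1} = H_0 ⊆ H_1 ⊆ … ⊆ H_k ⊆ [G,G] of G such that H_i ⊆ A^8·H_{i-1} for each i = 1,…,k, and such that [G,G] ⊆ A^4·H_k. In particular, [G,G] ⊆ A^{8K^8 + 4}. -/

import Mathlib

open Pointwise

/-- A finite symmetric subset `A` (with `1 ∈ A`) of a group `G` is a `K`-approximate
subgroup if there is a set `X ⊆ G` with `|X| ≤ K` and `A·A ⊆ X·A`. -/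
def IsKApproximateSubgroup {G : Type*} [Group G] (K : ℝ) (A : Set G) : Prop :=
  A.Finite ∧ A⁻¹ = A ∧ (1 : G) ∈ A ∧
    ∃ X : Set G, X.Finite ∧ (X.ncard : ℝ) ≤ K ∧ A * A ⊆ X * A

open scoped commutatorElement

lemma Set.finite_pow {G : Type*} [Monoid G] {A : Set G} (hA : A.Finite) (n : ℕ) :
    (A ^ n).Finite := by
  induction n with
  | zero => simp
  | succ n ih => rw [pow_succ]; exact ih.mul hA

lemma IsKApproximateSubgroup.isApproximateSubgroup {G : Type*} [Group G] {K : ℝ} {A : Set G}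
    (hA : IsKApproximateSubgroup K A) : IsApproximateSubgroup K A := by
  obtain ⟨-, hinv, hone, X, hX, hcard, hsub⟩ := hA
  refine ⟨hone, hinv, hX.toFinset, ?_, ?_⟩
  · rwa [← Set.ncard_eq_toFinset_card X hX]
  · simpa [sq] using hsub

/-- In a non-abelian nilpotent group, some element of the second centre is not central. -/
lemma exists_commutatorElement_mem_center_of_not_commutative {G : Type*} [Group G]
    [Group.IsNilpotent G] (h : Subgroup.center G ≠ ⊤) :
    ∃ g : G, (∀ x, ⁅g, x⁆ ∈ Subgroup.center G) ∧ ∃ x : G, ⁅g, x⁆ ≠ 1 := by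
  have : Nontrivial (G ⧸ Subgroup.center G) := QuotientGroup.nontrivial_iff.mpr h
  have hne := Group.IsNilpotent.center_ne_bot (G := G ⧸ Subgroup.center G)
  obtain ⟨q, hq, hq1⟩ := (Subgroup.bot_or_exists_ne_one _).resolve_left hne
  obtain ⟨g, rfl⟩ := QuotientGroup.mk_surjective q
  refine ⟨g, fun x => ?_, ?_⟩
  · rw [← QuotientGroup.eq_one_iff]
    have := Subgroup.mem_center_iff.mp hq (x : G ⧸ Subgroup.center G)
    change QuotientGroup.mk' _ ⁅g, x⁆ = 1
    rw [map_commutatorElement, commutatorElement_eq_one_iff_mul_comm]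
    exact this.symm
  · by_contra! hx
    refine hq1 ((QuotientGroup.eq_one_iff g).mpr (Subgroup.mem_center_iff.mpr fun x => ?_))
    exact (commutatorElement_eq_one_iff_mul_comm.mp (hx x)).symm

/-- A normal subgroup of a nilpotent group that lies properly inside the commutator subgroup can be
enlarged, inside the commutator subgroup, by commutators with a single element. -/
lemma exists_normal_gt_of_commutator_not_le {G : Type*} [Group G] [Group.IsNilpotent G]
    {N : Subgroup G} [N.Normal] (hN : N ≤ commutator G) (h : ¬ commutator G ≤ N) :
    ∃ M : Subgroup G, M.Normal ∧ N < M ∧ M ≤ commutator G ∧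
      ∃ g : G, ∀ m ∈ M, ∃ x, ∃ n ∈ N, ⁅g, x⁆ * n = m := by
  have hcenter : Subgroup.center (G ⧸ N) ≠ ⊤ := by
    intro htop
    refine h ?_
    rw [commutator_def, Subgroup.commutator_le]
    intro x _ y _
    rw [← QuotientGroup.eq_one_iff]
    change QuotientGroup.mk' N ⁅x, y⁆ = 1
    rw [map_commutatorElement, commutatorElement_eq_one_iff_mul_comm]
    have : QuotientGroup.mk' N y ∈ Subgroup.center (G ⧸ N) := htop ▸ Subgroup.mem_top _
    exact Subgroup.mem_center_iff.mp this _
  obtain ⟨q, hqc, r, hr⟩ := exists_commutatorElement_mem_center_of_not_commutative hcenter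
  obtain ⟨g, rfl⟩ := QuotientGroup.mk_surjective q
  obtain ⟨y, rfl⟩ := QuotientGroup.mk_surjective r
  let φ : G ⧸ N →* G ⧸ N :=
    { toFun := fun x => ⁅(g : G ⧸ N), x⁆
      map_one' := commutatorElement_one_right _
      map_mul' := fun x z => by
        have hz := Subgroup.mem_center_iff.mp (hqc z) x
        calc ⁅(g : G ⧸ N), x * z⁆ = ⁅(g : G ⧸ N), x⁆ * (x * ⁅(g : G ⧸ N), z⁆ * x⁻¹) := by
              simp only [commutatorElement_def]; group
          _ = _ := by rw [hz, mul_inv_cancel_right] }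
  have hφ : φ.range ≤ Subgroup.center (G ⧸ N) := by
    rintro _ ⟨x, rfl⟩
    exact hqc x
  have hφn : φ.range.Normal := ⟨fun n hn x => by
    rw [Subgroup.mem_center_iff.mp (hφ hn) x, mul_inv_cancel_right]
    exact hn⟩
  have hform : ∀ m ∈ φ.range.comap (QuotientGroup.mk' N), ∃ x, ∃ n ∈ N, ⁅g, x⁆ * n = m := by
    rintro m ⟨x, hx⟩
    obtain ⟨x, rfl⟩ := QuotientGroup.mk_surjective x
    refine ⟨x, ⁅g, x⁆⁻¹ * m, ?_, mul_inv_cancel_left _ _⟩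
    rw [← QuotientGroup.eq]
    exact hx
  refine ⟨φ.range.comap (QuotientGroup.mk' N), inferInstance, ?_, ?_, g, hform⟩
  · refine lt_of_le_not_ge (fun n hn => ?_) fun hle => hr ?_
    · rw [Subgroup.mem_comap, QuotientGroup.mk'_apply, (QuotientGroup.eq_one_iff n).mpr hn]
      exact one_mem _
    · have : ⁅g, y⁆ ∈ N := hle ⟨(y : G ⧸ N), rfl⟩
      exact (QuotientGroup.eq_one_iff _).mpr this
  · intro m hm
    obtain ⟨x, n, hn, rfl⟩ := hform m hm
    exact mul_mem (Subgroup.commutator_mem_commutator (Subgroup.mem_top g) (Subgroup.mem_top x))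
      (hN hn)

lemma commutatorElement_mem_pow_four {G : Type*} [Group G] {A : Set G} (hinv : A⁻¹ = A)
    (hAZ : A * (Subgroup.center G : Set G) = Set.univ) (x y : G) : ⁅x, y⁆ ∈ A ^ 4 := by
  obtain ⟨a, ha, z, hz, rfl⟩ : x ∈ A * (Subgroup.center G : Set G) := hAZ ▸ Set.mem_univ x
  obtain ⟨b, hb, w, hw, rfl⟩ : y ∈ A * (Subgroup.center G : Set G) := hAZ ▸ Set.mem_univ y
  have hz' := Subgroup.mem_center_iff.mp hz
  have hw' := Subgroup.mem_center_iff.mp hw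
  have key : ⁅a * z, b * w⁆ = a * b * a⁻¹ * b⁻¹ := by
    rw [commutatorElement_def, mul_inv_rev, mul_inv_rev]
    calc a * z * (b * w) * (z⁻¹ * a⁻¹) * (w⁻¹ * b⁻¹)
        = a * (z * (b * w)) * z⁻¹ * a⁻¹ * w⁻¹ * b⁻¹ := by group
      _ = a * b * (w * a⁻¹) * w⁻¹ * b⁻¹ := by rw [← hz' (b * w)]; group
      _ = a * b * a⁻¹ * b⁻¹ := by rw [← hw' a⁻¹]; group
  have ha' : a⁻¹ ∈ A := by rw [← hinv]; simpa using ha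
  have hb' : b⁻¹ ∈ A := by rw [← hinv]; simpa using hb
  change ⁅a * z, b * w⁆ ∈ A ^ 4
  rw [key, pow_succ, pow_succ, pow_succ, pow_one]
  exact Set.mul_mem_mul (Set.mul_mem_mul (Set.mul_mem_mul ha hb) ha') hb'

/-- An ascending chain `⊥ = H 0 ≤ ⋯ ≤ H k` of normal subgroups inside the commutator subgroup, each
covered by `A ^ 8` but not by `A ^ 2` modulo the previous one. -/
structure IsWideChain {G : Type*} [Group G] (A : Set G) (k : ℕ) (H : ℕ → Subgroup G) : Prop where
  zero : H 0 = ⊥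
  normal : ∀ i ≤ k, (H i).Normal
  le_commutator : ∀ i ≤ k, H i ≤ commutator G
  le_succ : ∀ i < k, H i ≤ H (i + 1)
  subset : ∀ i < k, (H (i + 1) : Set G) ⊆ A ^ 8 * (H i : Set G)
  not_subset : ∀ i < k, ¬ (H (i + 1) : Set G) ⊆ A ^ 2 * (H i : Set G)

namespace IsWideChain

variable {G : Type*} [Group G] {A : Set G} {k : ℕ} {H : ℕ → Subgroup G}

lemma bot (A : Set G) : IsWideChain A 0 fun _ => ⊥ where
  zero := rfl
  normal _ _ := inferInstance
  le_commutator _ _ := bot_le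
  le_succ _ h := absurd h (Nat.not_lt_zero _)
  subset _ h := absurd h (Nat.not_lt_zero _)
  not_subset _ h := absurd h (Nat.not_lt_zero _)

lemma le_of_le (hH : IsWideChain A k H) {i j : ℕ} (hij : i ≤ j) (hj : j ≤ k) : H i ≤ H j := by
  induction j, hij using Nat.le_induction with
  | base => exact le_rfl
  | succ j _ ih => exact (ih (by omega)).trans (hH.le_succ j (by omega))

lemma subset_pow (hH : IsWideChain A k H) {i : ℕ} (hi : i ≤ k) : (H i : Set G) ⊆ A ^ (8 * i) := by
  induction i with
  | zero => simp [hH.zero]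
  | succ i ih =>
    refine (hH.subset i hi).trans ?_
    rw [Nat.mul_succ, add_comm, pow_add]
    exact Set.mul_subset_mul_left (ih (by omega))

lemma snoc (hH : IsWideChain A k H) {M : Subgroup G} (hM : M.Normal) (hMc : M ≤ commutator G)
    (hle : H k ≤ M) (hsub : (M : Set G) ⊆ A ^ 8 * (H k : Set G))
    (hnot : ¬ (M : Set G) ⊆ A ^ 2 * (H k : Set G)) :
    IsWideChain A (k + 1) fun i => if i ≤ k then H i else M where
  zero := by simp [hH.zero]
  normal i hi := by
    split_ifs with h
    exacts [hH.normal i h, hM]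
  le_commutator i hi := by
    split_ifs with h
    exacts [hH.le_commutator i h, hMc]
  le_succ i hi := by
    rcases (Nat.lt_succ_iff.mp hi).lt_or_eq with h | rfl
    · simpa [h.le, Nat.succ_le_iff.mpr h] using hH.le_succ i h
    · simpa using hle
  subset i hi := by
    rcases (Nat.lt_succ_iff.mp hi).lt_or_eq with h | rfl
    · simpa [h.le, Nat.succ_le_iff.mpr h] using hH.subset i h
    · simpa using hsub
  not_subset i hi := by
    rcases (Nat.lt_succ_iff.mp hi).lt_or_eq with h | rfl
    · simpa [h.le, Nat.succ_le_iff.mpr h] using hH.not_subset i h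
    · simpa using hnot

lemma exists_mem_pow_eight (hH : IsWideChain A k H) {i : ℕ} (hi : i < k) :
    ∃ x ∈ A ^ 8, x ∈ H (i + 1) ∧ x ∉ A ^ 2 * (H i : Set G) := by
  obtain ⟨y, hy, hynot⟩ := Set.not_subset.mp (hH.not_subset i hi)
  obtain ⟨a, ha, h, hh, rfl⟩ := hH.subset i hi hy
  refine ⟨a, ha, ?_, ?_⟩
  · exact (Subgroup.mul_mem_cancel_right _ (hH.le_succ i hi hh)).mp hy
  · rintro ⟨b, hb, h', hh', rfl⟩
    exact hynot ⟨b, hb, h' * h, mul_mem hh' hh, (mul_assoc _ _ _).symm⟩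

/-- A wide chain is short: its steps provide disjoint translates of `A` inside `A ^ 9`. -/
lemma length_le (hH : IsWideChain A k H) {K : ℝ} (hA : IsApproximateSubgroup K A)
    (hfin : A.Finite) : (k : ℝ) ≤ K ^ 8 := by
  classical
  choose! x hx8 hxH hxnot using fun i (hi : i < k) => hH.exists_mem_pow_eight hi
  obtain ⟨B, rfl⟩ := hfin.exists_finset_coe
  have hdisj : ∀ i j a b, i < j → j < k → a ∈ B → b ∈ B → x i * a ≠ x j * b := by
    intro i j a b hij hj ha hb hab
    have hxi : x i ∈ H j := hH.le_of_le (i := i + 1) hij hj.le (hxH i (hij.trans hj))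
    have hb' : b⁻¹ ∈ (B : Set G) := by
      rw [← hA.inv_eq_self]; simpa using hb
    refine hxnot j hj ⟨a * b⁻¹, ?_, (a * b⁻¹)⁻¹ * x i * (a * b⁻¹), ?_, ?_⟩
    · rw [sq]; exact Set.mul_mem_mul ha hb'
    · simpa only [inv_inv, SetLike.mem_coe] using
        (hH.normal j hj.le).conj_mem _ hxi (a * b⁻¹)⁻¹
    · rw [← mul_inv_eq_iff_eq_mul] at hab
      rw [← hab]
      group
  have hinj : Set.InjOn (fun p : ℕ × G => x p.1 * p.2) (Finset.range k ×ˢ B : Finset (ℕ × G)) := by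
    rintro ⟨i, a⟩ hia ⟨j, b⟩ hjb hab
    simp only [Finset.coe_product, Set.mem_prod, Finset.mem_coe, Finset.mem_range] at hia hjb hab
    rcases lt_trichotomy i j with h | rfl | h
    · exact absurd hab (hdisj i j a b h hjb.1 hia.2 hjb.2)
    · rw [mul_left_cancel hab]
    · exact absurd hab.symm (hdisj j i b a h hia.1 hjb.2 hia.2)
  have hmaps : Set.MapsTo (fun p : ℕ × G => x p.1 * p.2)
      (Finset.range k ×ˢ B : Finset (ℕ × G)) (B ^ 9 : Finset G) := by
    rintro ⟨i, a⟩ hia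
    simp only [Finset.coe_product, Set.mem_prod, Finset.mem_coe, Finset.mem_range] at hia
    rw [Finset.coe_pow, pow_succ]
    exact Set.mul_mem_mul (hx8 i hia.1) hia.2
  have hcard := Finset.card_le_card_of_injOn _ hmaps hinj
  rw [Finset.card_product, Finset.card_range] at hcard
  have hpos : (0 : ℝ) < B.card := by
    exact_mod_cast Finset.card_pos.mpr ⟨1, hA.one_mem⟩
  refine le_of_mul_le_mul_right ?_ hpos
  calc (k : ℝ) * B.card ≤ (B ^ 9).card := by exact_mod_cast hcard
    _ ≤ K ^ 8 * B.card := hA.card_pow_le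

/-- A wide chain that cannot be extended exhausts the commutator subgroup up to `A ^ 2`. -/
lemma commutator_subset [Group.IsNilpotent G] (hH : IsWideChain A k H) (hfin : A.Finite)
    (hone : (1 : G) ∈ A) (hinv : A⁻¹ = A) (hAZ : A * (Subgroup.center G : Set G) = Set.univ)
    (hmax : ∀ H', ¬ IsWideChain A (k + 1) H') :
    (commutator G : Set G) ⊆ A ^ 2 * (H k : Set G) := by
  let S : Set (Subgroup G) :=
    {N | N.Normal ∧ H k ≤ N ∧ N ≤ commutator G ∧ (N : Set G) ⊆ A ^ 2 * (H k : Set G)}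
  have hS : S.Finite := by
    have hT : (A ^ 2 * (H k : Set G)).Finite :=
      (Set.finite_pow hfin 2).mul ((Set.finite_pow hfin (8 * k)).subset (hH.subset_pow le_rfl))
    exact (hT.finite_subsets.preimage SetLike.coe_injective.injOn).subset fun N hN => hN.2.2.2
  have hmem : H k ∈ S := ⟨hH.normal k le_rfl, le_rfl, hH.le_commutator k le_rfl,
    Set.subset_mul_right _ (Set.one_mem_pow hone)⟩
  obtain ⟨N, ⟨hNn, hHN, hNc, hNA⟩, hNmax⟩ := hS.exists_maximal ⟨_, hmem⟩
  by_contra hnot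
  have hNne : ¬ commutator G ≤ N := fun h => hnot (Set.Subset.trans h hNA)
  obtain ⟨M, hMn, hNM, hMc, g, hM⟩ := exists_normal_gt_of_commutator_not_le hNc hNne
  have hM8 : (M : Set G) ⊆ A ^ 8 * (H k : Set G) := by
    intro m hm
    obtain ⟨x, n, hn, rfl⟩ := hM m hm
    have h6 : A ^ 4 * A ^ 2 ⊆ A ^ 8 := by
      rw [← pow_add]; exact Set.pow_subset_pow_right hone (by norm_num)
    refine Set.mul_subset_mul_right h6 ?_
    rw [mul_assoc]
    exact Set.mul_mem_mul (commutatorElement_mem_pow_four hinv hAZ g x) (hNA hn)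
  by_cases hM2 : (M : Set G) ⊆ A ^ 2 * (H k : Set G)
  · exact hNM.not_ge (hNmax ⟨hMn, hHN.trans hNM.le, hMc, hM2⟩ hNM.le)
  · exact hmax _ (hH.snoc hMn hMc (hHN.trans hNM.le) hM8 hM2)

end IsWideChain

theorem statement_13 {G : Type*} [Group G] (hfg : Group.FG G)
    (hnilp : Group.IsNilpotent G) (K : ℝ) (hK : 1 ≤ K)
    (A : Set G) (hA : IsKApproximateSubgroup K A)
    (hAZ : A * (Subgroup.center G : Set G) = Set.univ) :
    ∃ (k : ℕ) (H : ℕ → Subgroup G),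
      (k : ℝ) ≤ K ^ 8 ∧
      H 0 = ⊥ ∧
      (∀ i, i ≤ k → (H i).Normal) ∧
      (∀ i, i < k → H i ≤ H (i + 1)) ∧
      H k ≤ commutator G ∧
      (∀ i, 1 ≤ i → i ≤ k → (H i : Set G) ⊆ A ^ 8 * (H (i - 1) : Set G)) ∧
      (commutator G : Set G) ⊆ A ^ 4 * (H k : Set G) ∧
      (commutator G : Set G) ⊆ A ^ (8 * ⌊K ^ 8⌋₊ + 4) := by
  classical
  have happ := hA.isApproximateSubgroup
  obtain ⟨hfin, hinv, hone, -⟩ := hA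
  have hbound : ∀ k, (∃ H, IsWideChain A k H) → k ≤ ⌊K ^ 8⌋₊ := fun k ⟨H, hH⟩ =>
    Nat.le_floor (hH.length_le happ hfin)
  let P : ℕ → Prop := fun k => ∃ H : ℕ → Subgroup G, IsWideChain A k H
  obtain ⟨H, hH⟩ : P (Nat.findGreatest P ⌊K ^ 8⌋₊) :=
    Nat.findGreatest_spec (Nat.zero_le _) ⟨_, IsWideChain.bot A⟩
  set k := Nat.findGreatest P ⌊K ^ 8⌋₊
  have hmax : ∀ H', ¬ IsWideChain A (k + 1) H' := fun H' hH' =>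
    (Nat.le_findGreatest (P := P) (hbound _ ⟨H', hH'⟩) ⟨H', hH'⟩).not_gt (Nat.lt_succ_self k)
  have hcomm : (commutator G : Set G) ⊆ A ^ 4 * (H k : Set G) :=
    (hH.commutator_subset hfin hone hinv hAZ hmax).trans
      (Set.mul_subset_mul_right (Set.pow_subset_pow_right hone (by norm_num)))
  refine ⟨k, H, hH.length_le happ hfin, hH.zero, hH.normal, hH.le_succ,
    hH.le_commutator k le_rfl, fun i hi hik => ?_, hcomm, ?_⟩
  · obtain ⟨j, rfl⟩ := Nat.exists_eq_add_of_le' hi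
    exact hH.subset j hik
  · refine hcomm.trans ((Set.mul_subset_mul_left (hH.subset_pow le_rfl)).trans ?_)
    rw [← pow_add]
    have := hbound k ⟨H, hH⟩
    exact Set.pow_subset_pow_right hone (by omega)
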